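/- arXiv:1307.8066 — 2 statements merged into one kernel-verified Lean document; each statement's English description precedes it below -/
import Mathlib

section
/- Let (L,▷) be a graded left pre-Lie algebra over K and let d be a degree-k derivation of the associated bracket. Define Φ(d)_2(x,y) := d(x)▷y + (−1)^{ki} x▷d(y) − d(x▷y), and Φ(d)_3(x,y,z) := (−1)^{ki} x▷Φ(d)_2(y,z) − Φ(d)_2(x▷y, z) − (−1)^{ij} Φ(d)_2(y, x▷z) for homogeneous x ∈ L^i, y ∈ L^j, z ∈ L^l. Then Φ(d)_3 is graded symmetric in all three arguments; in particular Φ(d)_3(x,y,z) = (−1)^{ij} Φ(d)_3(y,x,z) and Φ(d)_3(x,y,z) = (−1)^{jl} Φ(d)_3(x,z,y). -/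
theorem neg_one_zpow_eq_one_or_neg_one {K : Type*} [Field K] (n : ℤ) :
    (-1 : K) ^ n = 1 ∨ (-1 : K) ^ n = -1 := by
  rcases Int.even_or_odd n with h | h
  · exact Or.inl h.neg_one_zpow
  · exact Or.inr h.neg_one_zpow


/-- In a graded left pre-Lie algebra `(L,▷)` with a degree-`k` derivation `d`
of the associated bracket, the third Kapranov bracket
`Φ(d)₃(x,y,z) := (−1)^{ki} x▷Φ(d)₂(y,z) − Φ(d)₂(x▷y,z) − (−1)^{ij} Φ(d)₂(y,x▷z)` is graded
symmetric in all three arguments. -/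
theorem kapranov_cubic_bracket_symmetry
    (K : Type*) [Field K] [CharZero K]
    (L : Type*) [AddCommGroup L] [Module K L]
    (𝒜 : ℤ → Submodule K L) (hgr : DirectSum.IsInternal 𝒜)
    (smul : L →ₗ[K] L →ₗ[K] L)
    (hdeg : ∀ (i j : ℤ) (x y : L), x ∈ 𝒜 i → y ∈ 𝒜 j → smul x y ∈ 𝒜 (i + j))
    (hpre : ∀ (i j l : ℤ) (x y z : L), x ∈ 𝒜 i → y ∈ 𝒜 j → z ∈ 𝒜 l →
      smul (smul x y) z - smul x (smul y z) =
        ((-1 : K) ^ (i * j)) • (smul (smul y x) z - smul y (smul x z)))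
    (br : ℤ → ℤ → L → L → L)
    (hbr : ∀ (i j : ℤ) (x y : L), br i j x y = smul x y - ((-1 : K) ^ (i * j)) • smul y x)
    (k : ℤ) (d : L →ₗ[K] L)
    (hddeg : ∀ (i : ℤ) (x : L), x ∈ 𝒜 i → d x ∈ 𝒜 (i + k))
    (hder : ∀ (i j : ℤ) (x y : L), x ∈ 𝒜 i → y ∈ 𝒜 j →
      d (br i j x y) =
        br (i + k) j (d x) y + ((-1 : K) ^ (k * i)) • br i (j + k) x (d y))
    (Φ₂ : ℤ → L → L → L)
    (hΦ₂ : ∀ (i : ℤ) (x y : L),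
      Φ₂ i x y = smul (d x) y + ((-1 : K) ^ (k * i)) • smul x (d y) - d (smul x y))
    (Φ₃ : ℤ → ℤ → L → L → L → L)
    (hΦ₃ : ∀ (i j : ℤ) (x y z : L),
      Φ₃ i j x y z = ((-1 : K) ^ (k * i)) • smul x (Φ₂ j y z) - Φ₂ (i + j) (smul x y) z -
        ((-1 : K) ^ (i * j)) • Φ₂ j y (smul x z)) :
    ∀ (i j l : ℤ) (x y z : L), x ∈ 𝒜 i → y ∈ 𝒜 j → z ∈ 𝒜 l →
      Φ₃ i j x y z = ((-1 : K) ^ (i * j)) • Φ₃ j i y x z ∧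
      Φ₃ i j x y z = ((-1 : K) ^ (j * l)) • Φ₃ i l x z y := by
  have hadd (m n : ℤ) : (-1 : K) ^ (m + n) = (-1 : K) ^ m * (-1 : K) ^ n :=
    zpow_add₀ (by norm_num) m n
  have hsymm (i j : ℤ) (x y : L) (hx : x ∈ 𝒜 i) (hy : y ∈ 𝒜 j) :
      Φ₂ i x y = ((-1 : K) ^ (i * j)) • Φ₂ j y x := by
    have h := hder i j x y hx hy
    simp only [hbr, map_sub, map_smul, add_mul, mul_add, hadd, mul_comm i k] at h
    rw [hΦ₂, hΦ₂]
    rcases neg_one_zpow_eq_one_or_neg_one (K := K) (i * j) with ha | ha <;>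
    rcases neg_one_zpow_eq_one_or_neg_one (K := K) (k * i) with hb | hb <;>
    rcases neg_one_zpow_eq_one_or_neg_one (K := K) (k * j) with hc | hc <;>
    · linear_combination (norm := (simp only [ha, hb, hc]; module)) -h
  intro i j l x y z hx hy hz
  constructor
  · have hxy := congrArg (fun w => smul w z) (hder i j x y hx hy)
    have hxyz := congrArg d (hpre i j l x y z hx hy hz)
    have hdz := hpre i j (l + k) x y (d z) hx hy (hddeg l z hz)
    have hdx := hpre (i + k) j l (d x) y z (hddeg i x hx) hy hz
    have hdy := hpre i (j + k) l x (d y) z hx (hddeg j y hy) hz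
    simp only [hbr, map_sub, map_add, map_smul, LinearMap.sub_apply, LinearMap.add_apply,
      LinearMap.smul_apply, add_mul, mul_add, hadd, mul_comm i k] at hxy hxyz hdz hdx hdy
    simp only [hΦ₃, hΦ₂, map_sub, map_add, map_smul, mul_add, hadd, mul_comm j i]
    rcases neg_one_zpow_eq_one_or_neg_one (K := K) (i * j) with ha | ha <;>
    rcases neg_one_zpow_eq_one_or_neg_one (K := K) (k * i) with hb | hb <;>
    rcases neg_one_zpow_eq_one_or_neg_one (K := K) (k * j) with hc | hc <;>
    · linear_combination (norm := (simp only [ha, hb, hc]; module))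
        hxyz - hxy - hdx - ((-1 : K) ^ (k * i)) • hdy -
          ((-1 : K) ^ (k * i) * (-1 : K) ^ (k * j)) • hdz
  · rw [hΦ₃, hΦ₃, hsymm j l y z hy hz, hsymm (i + j) l _ z (hdeg i j x y hx hy) hz,
      hsymm j (i + l) y _ hy (hdeg i l x z hx hz)]
    simp only [map_smul, add_mul, mul_add, hadd, mul_comm j i]
    rcases neg_one_zpow_eq_one_or_neg_one (K := K) (i * j) with ha | ha <;>
    rcases neg_one_zpow_eq_one_or_neg_one (K := K) (i * l) with hb | hb <;>
    rcases neg_one_zpow_eq_one_or_neg_one (K := K) (j * l) with hc | hc <;>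
    · simp only [ha, hb, hc]
      module
end

section
/- Let K be a field and let 0 → A →(i) B →(p) C → 0 be a short exact sequence of cochain complexes of K-vector spaces (i and p are morphisms of complexes, and in each degree n the sequence 0 → A^n → B^n → C^n → 0 of vector spaces is exact). Then there exists a morphism of cochain complexes s : C → B with p∘s = id_C if and only if the induced map on cohomology H^n(i) : H^n(A) → H^n(B) is injective for every n ∈ ℤ. -/
open CategoryTheory

universe u v

section LinearAlgebra

variable {K : Type*} [Field K] {V W V' W' : Type*} [AddCommGroup V] [Module K V]
  [AddCommGroup W] [Module K W] [AddCommGroup V'] [Module K V'] [AddCommGroup W'] [Module K W']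

/-- A surjective linear map over a field that restricts to a surjection `ker d → ker e` has
a linear section mapping `ker e` into `ker d`. -/
lemma LinearMap.exists_section_mapping_ker (f : V →ₗ[K] W) (d : V →ₗ[K] V') (e : W →ₗ[K] W')
    (hf : Function.Surjective f) (hker : ∀ w, e w = 0 → ∃ v, d v = 0 ∧ f v = w) :
    ∃ s : W →ₗ[K] V, (∀ w, f (s w) = w) ∧ ∀ w, e w = 0 → d (s w) = 0 := by
  obtain ⟨σ, hσ⟩ := f.exists_rightInverse_of_surjective (LinearMap.range_eq_top.2 hf)
  obtain ⟨q, hq⟩ := (LinearMap.ker e).subtype.exists_leftInverse_of_injective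
    (LinearMap.ker_eq_bot.2 Subtype.val_injective)
  let P : Submodule K V := LinearMap.ker d ⊓ (LinearMap.ker e).comap f
  let g : P →ₗ[K] LinearMap.ker e := f.restrict fun _ hx => hx.2
  have hg : Function.Surjective g := by
    rintro ⟨w, hw⟩
    obtain ⟨v, hv, rfl⟩ := hker w hw
    exact ⟨⟨v, hv, hw⟩, rfl⟩
  obtain ⟨t, ht⟩ := g.exists_rightInverse_of_surjective (LinearMap.range_eq_top.2 hg)
  have hσ' (w : W) : f (σ w) = w := LinearMap.congr_fun hσ w
  have ht' (w : LinearMap.ker e) : f (t w : V) = w := congrArg Subtype.val (LinearMap.congr_fun ht w)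
  refine ⟨P.subtype ∘ₗ t ∘ₗ q + σ ∘ₗ (LinearMap.id - (LinearMap.ker e).subtype ∘ₗ q), ?_, ?_⟩
  · intro w
    simp [hσ', ht']
  · intro w hw
    have hqw : q w = ⟨w, hw⟩ := LinearMap.congr_fun hq ⟨w, hw⟩
    have : d (t ⟨w, hw⟩ : V) = 0 := (t ⟨w, hw⟩).2.1
    simp [hqw, this]

/-- Every linear map over a field has a generalized inverse. -/
lemma LinearMap.exists_generalized_inverse (d : V →ₗ[K] W) :
    ∃ h : W →ₗ[K] V, ∀ v, d (h (d v)) = d v := by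
  obtain ⟨σ, hσ⟩ := d.rangeRestrict.exists_rightInverse_of_surjective d.range_rangeRestrict
  obtain ⟨q, hq⟩ := (LinearMap.range d).subtype.exists_leftInverse_of_injective
    (LinearMap.ker_eq_bot.2 Subtype.val_injective)
  refine ⟨σ ∘ₗ q, fun v => ?_⟩
  have hqv : q (d v) = d.rangeRestrict v := LinearMap.congr_fun hq (d.rangeRestrict v)
  have := congrArg Subtype.val (LinearMap.congr_fun hσ (d.rangeRestrict v))
  simpa [hqv] using this

end LinearAlgebra

namespace CochainComplex

variable {K : Type u} [Field K]

lemma d_d_apply (X : CochainComplex (ModuleCat.{v} K) ℤ) (i j k : ℤ) (x : X.X i) :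
    X.d j k (X.d i j x) = 0 := by
  rw [← ModuleCat.comp_apply, X.d_comp_d]
  rfl

lemma hom_d_apply {X Y : CochainComplex (ModuleCat.{v} K) ℤ} (f : X ⟶ Y) (i j : ℤ) (x : X.X i) :
    Y.d i j (f.f i x) = f.f j (X.d i j x) := by
  rw [← ModuleCat.comp_apply, ← ModuleCat.comp_apply, f.comm]

lemma exists_cycles_of_d_eq_zero (X : CochainComplex (ModuleCat.{v} K) ℤ) (n : ℤ) (x : X.X n)
    (hx : X.d n (n + 1) x = 0) : ∃ z : X.cycles n, X.iCycles n z = x :=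
  (ShortComplex.moduleCat_exact_iff _).1
    (ShortComplex.exact_of_f_is_kernel (.mk _ _ (X.iCycles_d n (n + 1)))
      (X.cyclesIsKernel n (n + 1) (by simp))) x hx

lemma iCycles_injective (X : CochainComplex (ModuleCat.{v} K) ℤ) (n : ℤ) :
    Function.Injective (X.iCycles n) :=
  (ModuleCat.mono_iff_injective _).1 inferInstance

lemma homologyπ_eq_zero_iff (X : CochainComplex (ModuleCat.{v} K) ℤ) (n : ℤ) (z : X.cycles n) :
    X.homologyπ n z = 0 ↔ ∃ y : X.X (n - 1), X.d (n - 1) n y = X.iCycles n z := by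
  have key (y : X.X (n - 1)) : X.iCycles n (X.toCycles (n - 1) n y) = X.d (n - 1) n y := by
    rw [← ModuleCat.comp_apply, X.toCycles_i]
  constructor
  · intro hz
    obtain ⟨y, rfl⟩ := (ShortComplex.moduleCat_exact_iff _).1
      (ShortComplex.exact_of_g_is_cokernel (.mk _ _ (X.toCycles_comp_homologyπ (n - 1) n))
        (X.homologyIsCokernel (n - 1) n (by simp))) z hz
    exact ⟨y, (key y).symm⟩
  · rintro ⟨y, hy⟩
    obtain rfl : X.toCycles (n - 1) n y = z := X.iCycles_injective n ((key y).trans hy)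
    rw [← ModuleCat.comp_apply, X.toCycles_comp_homologyπ]
    rfl

/-- A morphism of complexes is injective on cohomology iff every cocycle whose image is a
coboundary is itself a coboundary. -/
lemma injective_homologyMap_iff {X Y : CochainComplex (ModuleCat.{v} K) ℤ} (f : X ⟶ Y) (n : ℤ) :
    Function.Injective (HomologicalComplex.homologyMap f n) ↔
      ∀ x : X.X n, X.d n (n + 1) x = 0 → (∃ y, Y.d (n - 1) n y = f.f n x) →
        ∃ x', X.d (n - 1) n x' = x := by
  have hi (z : X.cycles n) : Y.iCycles n (HomologicalComplex.cyclesMap f n z) =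
      f.f n (X.iCycles n z) := by
    rw [← ModuleCat.comp_apply, HomologicalComplex.cyclesMap_i, ModuleCat.comp_apply]
  have hπ (z : X.cycles n) : HomologicalComplex.homologyMap f n (X.homologyπ n z) =
      Y.homologyπ n (HomologicalComplex.cyclesMap f n z) := by
    rw [← ModuleCat.comp_apply, HomologicalComplex.homologyπ_naturality, ModuleCat.comp_apply]
  constructor
  · intro hf x hx hy
    obtain ⟨z, rfl⟩ := X.exists_cycles_of_d_eq_zero n x hx
    rw [← homologyπ_eq_zero_iff]
    apply hf
    rw [hπ, map_zero, homologyπ_eq_zero_iff, hi]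
    exact hy
  · intro h
    rw [injective_iff_map_eq_zero]
    intro α hα
    obtain ⟨z, rfl⟩ := (ModuleCat.epi_iff_surjective (X.homologyπ n)).1 inferInstance α
    rw [hπ, homologyπ_eq_zero_iff, hi] at hα
    rw [homologyπ_eq_zero_iff]
    refine h _ ?_ hα
    rw [← ModuleCat.comp_apply, X.iCycles_d]
    rfl

/-- A morphism of complexes of vector spaces that is surjective in each degree and on cocycles
is a split epimorphism of complexes. -/
lemma exists_section_of_surjective_on_cocycles {B C : CochainComplex (ModuleCat.{v} K) ℤ}
    (p : B ⟶ C) (hsurj : ∀ n, Function.Surjective (p.f n))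
    (hcocycles : ∀ n (c : C.X n), C.d n (n + 1) c = 0 →
      ∃ b, B.d n (n + 1) b = 0 ∧ p.f n b = c) :
    ∃ s : C ⟶ B, s ≫ p = 𝟙 C := by
  choose σ hpσ hdσ using fun n => LinearMap.exists_section_mapping_ker (p.f n).hom
    (B.d n (n + 1)).hom (C.d n (n + 1)).hom (hsurj n) (hcocycles n)
  choose h hh using fun i j => LinearMap.exists_generalized_inverse (C.d i j).hom
  let s (n : ℤ) : C.X n →ₗ[K] B.X n :=
    σ n ∘ₗ (LinearMap.id - (C.d (n - 1) n).hom ∘ₗ h (n - 1) n) +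
      (B.d (n - 1) n).hom ∘ₗ σ (n - 1) ∘ₗ h (n - 1) n
  have hs (n : ℤ) (c : C.X n) : s n c = σ n c - σ n (C.d (n - 1) n (h (n - 1) n c)) +
      B.d (n - 1) n (σ (n - 1) (h (n - 1) n c)) := by
    simp [s]
  refine ⟨{ f := fun n => ModuleCat.ofHom (s n), comm' := ?_ }, ?_⟩
  · intro i j hij
    obtain rfl : i + 1 = j := hij
    ext c
    change B.d i (i + 1) (s i c) = s (i + 1) (C.d i (i + 1) c)
    have hpred : i + 1 - 1 = i := by ring
    have hs' (c : C.X (i + 1)) : s (i + 1) c = σ (i + 1) c -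
        σ (i + 1) (C.d i (i + 1) (h i (i + 1) c)) +
        B.d i (i + 1) (σ i (h i (i + 1) c)) := by
      rw [hs, hpred]
    have h₁ : C.d i (i + 1) (h i (i + 1) (C.d i (i + 1) c)) = C.d i (i + 1) c := hh i (i + 1) c
    have h₂ : B.d i (i + 1) (σ i (C.d (i - 1) i (h (i - 1) i c))) = 0 :=
      hdσ i _ (C.d_d_apply _ _ _ _)
    have h₃ : B.d i (i + 1) (σ i (c - h i (i + 1) (C.d i (i + 1) c))) = 0 :=
      hdσ i _ (by
        change C.d i (i + 1) _ = 0
        rw [map_sub, h₁, sub_self])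
    rw [map_sub, map_sub, sub_eq_zero] at h₃
    rw [hs', hs, h₁, map_add, map_sub, h₂, d_d_apply, h₃]
    simp
  · ext n c
    change p.f n (s n c) = c
    have hp (c : C.X n) : p.f n (σ n c) = c := hpσ n c
    have hp' (c : C.X (n - 1)) : p.f (n - 1) (σ (n - 1) c) = c := hpσ (n - 1) c
    rw [hs, map_add, map_sub, hp, hp, ← hom_d_apply, hp']
    simp

end CochainComplex

open CochainComplex in
/-- A degreewise short exact sequence `0 → A → B → C → 0` of cochain
complexes of vector spaces over a field admits a chain-level splitting `s : C → B` with
`p∘s = id` if and only if the induced maps `Hⁿ(i) : Hⁿ(A) → Hⁿ(B)` are injective for all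
`n`. -/
theorem ses_of_complexes_splits_iff_injective_on_cohomology
    (K : Type*) [Field K]
    (A B C : CochainComplex (ModuleCat K) ℤ)
    (i : A ⟶ B) (p : B ⟶ C)
    (hinj : ∀ n : ℤ, Function.Injective (i.f n))
    (hsurj : ∀ n : ℤ, Function.Surjective (p.f n))
    (hexact : ∀ (n : ℤ) (b : B.X n), p.f n b = 0 ↔ b ∈ Set.range (i.f n)) :
    (∃ s : C ⟶ B, s ≫ p = 𝟙 C) ↔
      ∀ n : ℤ, Function.Injective (HomologicalComplex.homologyMap i n) := by
  simp only [injective_homologyMap_iff]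
  have hpi (n : ℤ) (a : A.X n) : p.f n (i.f n a) = 0 := (hexact n _).2 ⟨a, rfl⟩
  constructor
  · rintro ⟨s, hs⟩ n a - ⟨b, hb⟩
    have hps (m : ℤ) (c : C.X m) : p.f m (s.f m c) = c := by
      rw [← ModuleCat.comp_apply, ← HomologicalComplex.comp_f, hs]
      rfl
    obtain ⟨a', ha'⟩ := (hexact (n - 1) (b - s.f (n - 1) (p.f (n - 1) b))).1 (by
      rw [map_sub, hps, sub_self])
    refine ⟨a', hinj n ?_⟩
    rw [← hom_d_apply, ha', map_sub, hom_d_apply, hom_d_apply, hb, hpi, map_zero, sub_zero]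
  · intro h
    refine exists_section_of_surjective_on_cocycles p hsurj fun n c hc => ?_
    obtain ⟨b, rfl⟩ := hsurj n c
    obtain ⟨a, ha⟩ := (hexact (n + 1) (B.d n (n + 1) b)).1 (by rw [← hom_d_apply, hc])
    have hda : A.d (n + 1) (n + 1 + 1) a = 0 := hinj _ (by
      rw [← hom_d_apply, ha, d_d_apply, map_zero])
    have hpred : n + 1 - 1 = n := by ring
    have h' := h (n + 1) a hda
    rw [hpred] at h'
    obtain ⟨a', rfl⟩ := h' ⟨b, ha.symm⟩
    refine ⟨b - i.f n a', ?_, ?_⟩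
    · rw [map_sub, hom_d_apply, ha, sub_self]
    · rw [map_sub, hpi, sub_zero]
end
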